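/- Let F be a non-archimedean local field and E/F a ramified quadratic extension. Put G = GL₂(E), K = GL₂(F), and let H ⊆ G be the subgroup of matrices whose diagonal entries lie in 1 + 𝔭_E and whose off-diagonal entries lie in 𝔭_E, where 𝔭_E is the maximal ideal of the ring of integers of E. Then for every open subgroup U of G one has HKU ≠ HK; equivalently, the characteristic function of HK on G is not fixed by any open subgroup of G under right translation. -/

import Mathlib

open scoped Pointwise
open scoped WithZero

/-- If `E` is algebraic over a subfield `F` and the valuation of `E` is nontrivial, then so is its
restriction to `F`. -/
theorem Valuation.exists_mem_subfield_lt_one {E Γ₀ : Type*} [Field E]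
    [LinearOrderedCommGroupWithZero Γ₀] (v : Valuation E Γ₀) (F : Subfield E)
    [Algebra.IsAlgebraic F E] {x : E} (hx0 : x ≠ 0) (hx : v x < 1) :
    ∃ y ∈ F, y ≠ 0 ∧ v y < 1 := by
  by_contra! h
  have hF : ∀ y ∈ F, v y ≤ 1 := fun y hy ↦ by
    rcases eq_or_ne y 0 with rfl | hy0
    · simp
    · have := h y⁻¹ (F.inv_mem hy) (inv_ne_zero hy0)
      rwa [map_inv₀, one_le_inv₀ (by simpa [zero_lt_iff] using hy0)] at this
  obtain ⟨p, hp, hpx⟩ := Algebra.IsIntegral.isIntegral (R := F) x⁻¹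
  let g : F →+* v.integer := F.subtype.codRestrict v.integer fun y ↦ hF y y.2
  have hint : IsIntegral v.integer x⁻¹ :=
    ⟨p.map g, hp.map g, by rw [Polynomial.eval₂_map]; exact hpx⟩
  have hle : v x⁻¹ ≤ 1 := (Valuation.integer.integers v).mem_of_integral hint
  rw [map_inv₀, inv_le_one₀ (by simpa [zero_lt_iff] using hx0)] at hle
  exact hx.not_ge hle

/-- If `s` has valuation less than `1`, an open subgroup of `GL₂(E)` contains the upper unipotent
matrix with upper right entry `s ^ n * y` for some `n`. -/
theorem exists_upperRightHom_pow_mul_mem {E : Type*} [Field E] [Valued E ℤᵐ⁰]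
    {U : Subgroup (Matrix.GeneralLinearGroup (Fin 2) E)}
    (hU : IsOpen (U : Set (Matrix.GeneralLinearGroup (Fin 2) E)))
    {s : E} (hs : Valued.v s < 1) (y : E) :
    ∃ n : ℕ, Matrix.GeneralLinearGroup.upperRightHom (s ^ n * y) ∈ U := by
  have hpow : Filter.Tendsto (fun n : ℕ ↦ s ^ n * y) Filter.atTop (nhds 0) := by
    simpa using (Valued.tendsto_zero_pow_of_v_lt_one hs).mul_const y
  have hlim := (Matrix.GeneralLinearGroup.continuous_upperRightHom.tendsto (0 : E)).comp hpow
  rw [AddChar.map_zero_eq_one] at hlim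
  exact (hlim.eventually (hU.mem_nhds U.one_mem)).exists

/-- If `h k = !![t, y; 0, 1]` with `k` having entries in `F` and `t ∈ F`, then the second column
of `h` is `(y a - b, a)` with `a, b ∈ F`. -/
theorem exists_second_column_of_mul_eq {E : Type*} [Field E] (F : Subfield E)
    {h k : Matrix (Fin 2) (Fin 2) E} (hk : ∀ i j, k i j ∈ F) (hdet : k.det ≠ 0)
    {t y : E} (ht : t ∈ F) (hmul : h * k = !![t, y; 0, 1]) :
    ∃ a ∈ F, ∃ b ∈ F, h 0 1 = y * a - b ∧ h 1 1 = a := by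
  have e00 := congrFun₂ hmul 0 0
  have e01 := congrFun₂ hmul 0 1
  have e10 := congrFun₂ hmul 1 0
  have e11 := congrFun₂ hmul 1 1
  simp only [Matrix.mul_apply, Fin.sum_univ_two, Matrix.of_apply, Matrix.cons_val',
    Matrix.cons_val_zero, Matrix.cons_val_one, Matrix.cons_val_fin_one] at e00 e01 e10 e11
  have hdetF : k.det ∈ F := by
    rw [Matrix.det_fin_two]
    exact F.sub_mem (F.mul_mem (hk _ _) (hk _ _)) (F.mul_mem (hk _ _) (hk _ _))
  refine ⟨k 0 0 / k.det, F.div_mem (hk _ _) hdetF, t * k 0 1 / k.det,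
    F.div_mem (F.mul_mem ht (hk _ _)) hdetF, ?_, ?_⟩
  · rw [mul_div_assoc', ← sub_div, eq_div_iff hdet, Matrix.det_fin_two]
    linear_combination k 0 0 * e01 - k 0 1 * e00
  · rw [eq_div_iff hdet, Matrix.det_fin_two]
    linear_combination k 0 0 * e11 - k 0 1 * e10

/-- Let `E/F` be a ramified quadratic extension of non-archimedean local fields, let
`G = GL₂(E)`, `K = GL₂(F)` and let `H` be the compact open subgroup of matrices congruent
to `1` modulo the maximal ideal `𝔭_E`.  Then `H K U ≠ H K` for every open subgroup `U` of
`G`. -/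
theorem HKU_ne_HK
    (E : Type*) [Field E] [Valued E (WithZero (Multiplicative ℤ))]
    [CompleteSpace E] [LocallyCompactSpace E]
    (hsurj : ∃ π : E, Valued.v π =
      ((Multiplicative.ofAdd (-1 : ℤ) : Multiplicative ℤ) : WithZero (Multiplicative ℤ)))
    (F : Subfield E)
    (hquad : Module.finrank F E = 2)
    (hram : ∀ x : E, x ∈ F → x ≠ 0 → ∃ n : ℤ, Valued.v x =
      ((Multiplicative.ofAdd (2 * n) : Multiplicative ℤ) : WithZero (Multiplicative ℤ)))
    (U : Subgroup (Matrix.GeneralLinearGroup (Fin 2) E))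
    (hU : IsOpen (U : Set (Matrix.GeneralLinearGroup (Fin 2) E))) :
    ({A : Matrix.GeneralLinearGroup (Fin 2) E |
        (∀ i, Valued.v ((A : Matrix (Fin 2) (Fin 2) E) i i - 1) < 1) ∧
        (∀ i j, i ≠ j → Valued.v ((A : Matrix (Fin 2) (Fin 2) E) i j) < 1)} *
      {A : Matrix.GeneralLinearGroup (Fin 2) E |
        ∀ i j, (A : Matrix (Fin 2) (Fin 2) E) i j ∈ F} *
      (U : Set (Matrix.GeneralLinearGroup (Fin 2) E))) ≠
    ({A : Matrix.GeneralLinearGroup (Fin 2) E |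
        (∀ i, Valued.v ((A : Matrix (Fin 2) (Fin 2) E) i i - 1) < 1) ∧
        (∀ i j, i ≠ j → Valued.v ((A : Matrix (Fin 2) (Fin 2) E) i j) < 1)} *
      {A : Matrix.GeneralLinearGroup (Fin 2) E |
        ∀ i j, (A : Matrix (Fin 2) (Fin 2) E) i j ∈ F}) := by
  obtain ⟨π, hπ⟩ := hsurj
  change Valued.v π = WithZero.exp (-1 : ℤ) at hπ
  have hπ0 : π ≠ 0 := by
    rintro rfl
    rw [map_zero] at hπ
    exact WithZero.exp_ne_zero hπ.symm
  have : FiniteDimensional F E := Module.finite_of_finrank_pos (by omega)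
  obtain ⟨s, hsF, hs0, hs⟩ := Valued.v.exists_mem_subfield_lt_one F hπ0
    (by rw [hπ, ← WithZero.exp_zero, WithZero.exp_lt_exp]; norm_num)
  obtain ⟨n, hn⟩ := exists_upperRightHom_pow_mul_mem hU hs π⁻¹
  have htF : (s ^ n)⁻¹ ∈ F := F.inv_mem (F.pow_mem hsF n)
  intro heq
  let k := Matrix.GeneralLinearGroup.mkOfDetNeZero !![(s ^ n)⁻¹, 0; 0, 1]
    (by simp [Matrix.det_fin_two, hs0])
  have hmem := heq.subset (Set.mul_mem_mul (Set.mul_mem_mul (a := 1) (b := k)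
    (by constructor <;> simp +contextual) fun i j ↦ ?_) hn)
  swap
  · fin_cases i <;> fin_cases j <;>
      simp [k, Matrix.GeneralLinearGroup.mkOfDetNeZero, htF, -inv_pow, F.zero_mem, F.one_mem]
  obtain ⟨h, ⟨hdiag, hoff⟩, k', hk', hmul⟩ := hmem
  have hmul' : (h : Matrix (Fin 2) (Fin 2) E) * (k' : Matrix (Fin 2) (Fin 2) E) =
      !![(s ^ n)⁻¹, π⁻¹; 0, 1] := by
    rw [← Units.val_mul]
    refine (congrArg Units.val hmul).trans ?_
    simp [k, Matrix.GeneralLinearGroup.mkOfDetNeZero, hs0]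
  obtain ⟨a, haF, b, hbF, h01, h11⟩ := exists_second_column_of_mul_eq F hk'
    (Matrix.GeneralLinearGroup.det_ne_zero k') htF hmul'
  have hva : Valued.v a = 1 := by
    have := hdiag 1
    rw [h11] at this
    rw [Valued.v.map_eq_of_sub_lt (x := (1 : E)) (by rwa [map_one]), map_one]
  have hvy : Valued.v (π⁻¹ * a) = WithZero.exp (1 : ℤ) := by
    rw [map_mul, hva, map_inv₀, hπ, mul_one, ← WithZero.exp_neg, neg_neg]
  have hlt : Valued.v (b - π⁻¹ * a) < Valued.v (π⁻¹ * a) := by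
    rw [Valuation.map_sub_swap, ← h01, hvy]
    refine (hoff 0 1 (by simp)).trans ?_
    rw [← WithZero.exp_zero, WithZero.exp_lt_exp]
    norm_num
  have hvb : Valued.v b = WithZero.exp (1 : ℤ) := (Valued.v.map_eq_of_sub_lt hlt).trans hvy
  obtain ⟨m, hm⟩ := hram b hbF (by
    rintro rfl
    rw [map_zero] at hvb
    exact WithZero.exp_ne_zero hvb.symm)
  change _ = WithZero.exp (2 * m) at hm
  rw [hvb, WithZero.exp_inj] at hm
  omega
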